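/- Let k be a positive integer, let Z_1, …, Z_k be finite sets each equipped with a strict partial order and a strict linear order extending it, and let C be their join. Let A and B be finite sets each equipped with a strict partial order and k linear orders extending it. If π is a canonical copy of B in C and σ is an order preserving map witnessing a copy of A inside the copy π(B) of B in C (i.e., σ is order preserving from A into the restriction of C to the image of π), then σ is a canonical copy of A in C. -/

import Mathlib

/-- `π` is order preserving for the `PL^(1)` structures `(α, P, L)` and `(β, P', L')`. -/
def OrderPres {α β : Type} (P L : α → α → Prop) (P' L' : β → β → Prop)
    (π : α → β) : Prop :=
  (∀ x y, P x y ↔ P' (π x) (π y)) ∧ (∀ x y, L x y ↔ L' (π x) (π y))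

/-- `π` is order preserving for the `PL^(k)` structures `(α, P, L)` and `(β, P', L')`. -/
def OrderPresK {k : ℕ} {α β : Type} (P : α → α → Prop) (L : Fin k → α → α → Prop)
    (P' : β → β → Prop) (L' : Fin k → β → β → Prop) (π : α → β) : Prop :=
  (∀ x y, P x y ↔ P' (π x) (π y)) ∧ ∀ i x y, L i x y ↔ L' i (π x) (π y)

/-- The product partial order on `C = Z 1 × ⋯ × Z k`:
`x <_C y` iff `x i (P i) y i` in every coordinate. -/
def prodLT {k : ℕ} {Z : Fin k → Type} (P : ∀ i, Z i → Z i → Prop)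
    (x y : ∀ i, Z i) : Prop :=
  ∀ i, P i (x i) (y i)

open scoped Fin.NatCast in
/-- The `i`-th shifted lexicographic order on `C = Z 1 × ⋯ × Z k`:
`x <_{lx_i} y` iff `x (i+δ) (L (i+δ)) y (i+δ)`, where `δ` is the least `j ≥ 0`
with `x (i+j) ≠ y (i+j)` (indices mod `k`). -/
def shiftLex {k : ℕ} [NeZero k] {Z : Fin k → Type} (L : ∀ i, Z i → Z i → Prop)
    (i : Fin k) (x y : ∀ j, Z j) : Prop :=
  ∃ δ : ℕ, (∀ j < δ, x (i + (j : Fin k)) = y (i + (j : Fin k))) ∧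
    x (i + (δ : Fin k)) ≠ y (i + (δ : Fin k)) ∧
    L (i + (δ : Fin k)) (x (i + (δ : Fin k))) (y (i + (δ : Fin k)))

/-- `S` is a canonical copy of the `PL^(k)` structure `A = (X, P^X, (L_1^X, …, L_k^X))`
in the join of the `PL^(1)` structures `Z 1, …, Z k`: it is the image of a diagonal map
`x ↦ (π 1 x, …, π k x)` where each `π i` is order preserving for `(X, P^X, L_i^X)`
and `Z i`. -/
def IsCanonicalCopy {k : ℕ} {X : Type} {Z : Fin k → Type}
    (PX : X → X → Prop) (LX : Fin k → X → X → Prop)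
    (PZ LZ : ∀ i, Z i → Z i → Prop) (S : Set (∀ i, Z i)) : Prop :=
  ∃ π : ∀ i, X → Z i,
    (∀ i, OrderPres PX (LX i) (PZ i) (LZ i) (π i)) ∧
    Set.range (fun x j => π j x) = S

/-- If `π = (π 1, …, π k)` is a canonical copy of `B` in the join `C` of `Z 1, …, Z k`,
and `σ : X → C` is an order preserving map for `A` and `C` whose image lies inside the
copy `π(B)` (so `σ` witnesses a copy of `A` inside `π(B)`), then `σ` is a canonical copy
of `A` in `C`: each coordinate map `x ↦ σ x i` is order preserving for `(X, P^X, L_i^X)`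
and `Z i`, and the image of `σ` is a canonical copy of `A` in `C`. -/
theorem copy_inside_canonical_copy_is_canonical
    (k : ℕ) [NeZero k]
    (Z : Fin k → Type) (_ : ∀ i, Fintype (Z i))
    (PZ LZ : ∀ i, Z i → Z i → Prop)
    (hPZ : ∀ i, IsStrictOrder (Z i) (PZ i))
    (hLZ : ∀ i, IsStrictTotalOrder (Z i) (LZ i))
    (hZext : ∀ i x y, PZ i x y → LZ i x y)
    (X Y : Type) (_ : Fintype X) (_ : Fintype Y)
    (PX : X → X → Prop) (LX : Fin k → X → X → Prop)
    (hPX : IsStrictOrder X PX)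
    (hLX : ∀ i, IsStrictTotalOrder X (LX i))
    (hXext : ∀ i x y, PX x y → LX i x y)
    (PY : Y → Y → Prop) (LY : Fin k → Y → Y → Prop)
    (hPY : IsStrictOrder Y PY)
    (hLY : ∀ i, IsStrictTotalOrder Y (LY i))
    (hYext : ∀ i x y, PY x y → LY i x y)
    (π : ∀ i, Y → Z i)
    (hπ : ∀ i, OrderPres PY (LY i) (PZ i) (LZ i) (π i))
    (σ : X → ∀ j, Z j)
    (hσ : OrderPresK PX LX (prodLT PZ) (shiftLex LZ) σ)
    (hσsub : Set.range σ ⊆ Set.range (fun y j => π j y)) :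
    (∀ i, OrderPres PX (LX i) (PZ i) (LZ i) (fun x => σ x i)) ∧
    IsCanonicalCopy PX LX PZ LZ (Set.range σ) := by
  have hinj : ∀ i a b, π i a = π i b → a = b := by
    intro i a b h
    have := hLY i
    have := hLZ i
    rcases trichotomous_of (LY i) a b with h1 | h1 | h1
    · have h2 := ((hπ i).2 a b).1 h1
      rw [h] at h2
      exact absurd h2 (irrefl_of (LZ i) _)
    · exact h1
    · have h2 := ((hπ i).2 b a).1 h1
      rw [h] at h2
      exact absurd h2 (irrefl_of (LZ i) _)
  have hy : ∀ x, ∃ y, (fun j => π j y) = σ x := fun x => hσsub ⟨x, rfl⟩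
  choose f hf using hy
  have key : ∀ i, OrderPres PX (LX i) (PZ i) (LZ i) (fun x => σ x i) := by
    intro i
    refine ⟨fun x y => ?_, fun x y => ?_⟩
    · rw [hσ.1 x y]
      refine ⟨fun h => h i, fun h j => ?_⟩
      simp only [← hf] at h ⊢
      exact ((hπ j).1 _ _).1 (((hπ i).1 _ _).2 h)
    · rw [hσ.2 i x y]
      have e : i + Fin.ofNat k 0 = i := by
        apply Fin.ext
        simp [Fin.val_add, Nat.mod_eq_of_lt i.isLt]
      constructor
      · rintro ⟨δ, h1, h2, h3⟩
        rcases Nat.eq_zero_or_pos δ with h0 | h0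
        · subst h0
          change LZ (i + Fin.ofNat k 0) (σ x (i + Fin.ofNat k 0)) (σ y (i + Fin.ofNat k 0)) at h3
          rwa [e] at h3
        · exfalso
          have h4 := h1 0 h0
          apply h2
          simp only [← hf] at h4 ⊢
          rw [hinj _ _ _ h4]
      · intro h
        have := hLZ i
        refine ⟨0, fun j hj => absurd hj (Nat.not_lt_zero j), ?_, ?_⟩
        swap
        · change LZ (i + Fin.ofNat k 0) (σ x (i + Fin.ofNat k 0)) (σ y (i + Fin.ofNat k 0))
          rwa [e]
        change σ x (i + Fin.ofNat k 0) ≠ σ y (i + Fin.ofNat k 0)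
        rw [e]
        intro h5
        simp only [h5] at h
        exact irrefl_of (LZ i) _ h
  exact ⟨key, fun i x => σ x i, key, rfl⟩
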